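/- Large deviations for sums of log-normal variables: there exist constants ε₀ ∈ (0,1), K ≥ 1, c > 0 and C > 0 such that the following holds. Let n ≥ 1 be an integer, ε ∈ (0,ε₀], and let Z₁,…,Zₙ be independent standard real Gaussian random variables. Set Sₙ := Σ_{i=1}^n ( e^{ε|Zᵢ|} − E[e^{ε|Zᵢ|}] ) and S̃ₙ := Σ_{i=1}^n ( e^{ε|Zᵢ|} − 1 ). Then for every A ≥ K·max(1, nε), one has P[Sₙ > A] ≤ C·(A/ε)^{−c·ln(A/ε)} and P[S̃ₙ > A] ≤ C·(A/ε)^{−c·ln(A/ε)}. -/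

import Mathlib

open MeasureTheory Real ProbabilityTheory
open scoped ENNReal

noncomputable section

/-- The square of a standard Gaussian variable has a finite exponential moment of order `1/4`. -/
lemma integrable_exp_sq_div_four_gaussianReal :
    Integrable (fun z : ℝ => Real.exp (9 + z ^ 2 / 4)) (gaussianReal 0 1) := by
  rw [gaussianReal_of_var_ne_zero 0 one_ne_zero,
    integrable_withDensity_iff (measurable_gaussianPDF 0 1)
      (Filter.Eventually.of_forall fun _ => gaussianPDF_lt_top)]
  have h := (integrable_exp_neg_mul_sq (b := 1 / 4) (by norm_num)).const_mul
    (Real.exp 9 * (√(2 * π * 1))⁻¹)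
  refine h.congr (Filter.Eventually.of_forall fun z => ?_)
  simp only [toReal_gaussianPDF, gaussianPDFReal, NNReal.coe_one, sub_zero]
  have e : Real.exp (-(1 / 4) * z ^ 2) = Real.exp (z ^ 2 / 4) * Real.exp (-z ^ 2 / (2 * 1)) := by
    rw [← Real.exp_add]; ring_nf
  rw [e, Real.exp_add]
  ring

lemma exp_mul_abs_sub_one_le {ε : ℝ} (hε : 0 < ε) (hε1 : ε ≤ 1 / 2) (z : ℝ) :
    Real.exp (ε * |z|) - 1 ≤ ε * Real.exp (2 * |z|) := by
  have h0 := abs_nonneg z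
  have h1 : 1 - ε * |z| ≤ Real.exp (-(ε * |z|)) := by
    linarith [Real.add_one_le_exp (-(ε * |z|))]
  have h2 : Real.exp (ε * |z|) * Real.exp (-(ε * |z|)) = 1 := by
    rw [← Real.exp_add]; simp
  have h3 : Real.exp (ε * |z|) - 1 ≤ ε * |z| * Real.exp (ε * |z|) := by
    nlinarith [Real.exp_pos (ε * |z|)]
  have h4 : |z| * Real.exp (ε * |z|) ≤ Real.exp (2 * |z|) := by
    calc |z| * Real.exp (ε * |z|) ≤ Real.exp |z| * Real.exp |z| := by
          gcongr
          · linarith [Real.add_one_le_exp |z|]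
          · nlinarith
      _ = Real.exp (2 * |z|) := by rw [← Real.exp_add]; ring_nf
  nlinarith

/-- The truncated variable `min (e^{ε|z|} - 1) A`, tilted by `log (A/ε)² / (32 A)`, is
dominated by a small multiple of `1 + z²`. -/
lemma tilted_truncation_le {ε A : ℝ} (hε : 0 < ε) (hε1 : ε ≤ 1 / 2) (hA : 0 < A)
    (hAε : Real.exp 2 ≤ A / ε) (z : ℝ) :
    Real.log (A / ε) ^ 2 / (32 * A) * min (Real.exp (ε * |z|) - 1) A ≤ (1 + z ^ 2) / 8 := by
  set Y := min (Real.exp (ε * |z|) - 1) A with hY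
  set w := max (Y / ε) (Real.exp 2) with hw
  have hw2 : Real.exp 2 ≤ w := le_max_right _ _
  have hw0 : 0 < w := (Real.exp_pos 2).trans_le hw2
  have hwA : w ≤ A / ε := max_le (by gcongr; exact min_le_right _ _) hAε
  have hanti := Real.log_div_sqrt_antitoneOn (Set.mem_ofPred.2 hw2) (Set.mem_ofPred.2 hAε) hwA
  have hlogA : 0 ≤ Real.log (A / ε) := Real.log_nonneg (by linarith [Real.add_one_le_exp 2])
  have hlogw : 0 ≤ Real.log w := Real.log_nonneg (by linarith [Real.add_one_le_exp 2])
  have hsq : Real.log (A / ε) ^ 2 / (A / ε) ≤ Real.log w ^ 2 / w := by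
    have := pow_le_pow_left₀ (by positivity) hanti 2
    simpa only [div_pow, Real.sq_sqrt hw0.le, Real.sq_sqrt (div_pos hA hε).le] using this
  have hwle : w ≤ Real.exp (2 * max |z| 1) := by
    refine max_le ?_ (Real.exp_le_exp.2 (by linarith [le_max_right |z| 1]))
    rw [div_le_iff₀ hε]
    calc Y ≤ ε * Real.exp (2 * |z|) :=
          (min_le_left _ _).trans (exp_mul_abs_sub_one_le hε hε1 z)
      _ ≤ ε * Real.exp (2 * max |z| 1) := by gcongr; exact le_max_left _ _
      _ = _ := mul_comm _ _
  have hlogle : Real.log w ≤ 2 * max |z| 1 := (Real.log_le_iff_le_exp hw0).2 hwle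
  have hlogsq : Real.log w ^ 2 ≤ 4 * (1 + z ^ 2) := by
    have h1 : Real.log w ^ 2 ≤ (2 * max |z| 1) ^ 2 := pow_le_pow_left₀ hlogw hlogle 2
    rcases max_choice |z| 1 with h | h <;> rw [h] at h1
    · nlinarith [sq_abs z]
    · nlinarith [sq_nonneg z]
  have key : Real.log (A / ε) ^ 2 / (A / ε) * (Y / ε) ≤ 4 * (1 + z ^ 2) :=
    calc Real.log (A / ε) ^ 2 / (A / ε) * (Y / ε) ≤ Real.log (A / ε) ^ 2 / (A / ε) * w := by
          gcongr; exact le_max_left _ _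
      _ ≤ Real.log w ^ 2 / w * w := by gcongr
      _ = Real.log w ^ 2 := by field_simp
      _ ≤ _ := hlogsq
  have e : Real.log (A / ε) ^ 2 / (32 * A) * Y
      = Real.log (A / ε) ^ 2 / (A / ε) * (Y / ε) / 32 := by
    field_simp
  rw [e]
  linarith

lemma exp_tilted_truncation_le {ε A : ℝ} (hε : 0 < ε) (hε1 : ε ≤ 1 / 2) (hA : 0 < A)
    (hAε : Real.exp 2 ≤ A / ε) (z : ℝ) :
    Real.exp (Real.log (A / ε) ^ 2 / (32 * A) * min (Real.exp (ε * |z|) - 1) A) ≤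
      1 + Real.log (A / ε) ^ 2 / (32 * A) * ε * Real.exp (9 + z ^ 2 / 4) := by
  have hle := tilted_truncation_le hε hε1 hA hAε z
  have hX := (min_le_left _ A).trans (exp_mul_abs_sub_one_le hε hε1 z)
  set Y := min (Real.exp (ε * |z|) - 1) A
  have hl : 0 ≤ Real.log (A / ε) ^ 2 / (32 * A) := by positivity
  set l := Real.log (A / ε) ^ 2 / (32 * A)
  have h1 : Real.exp (l * Y) ≤ 1 + l * Y * Real.exp (l * Y) := by
    have h2 : Real.exp (l * Y) * Real.exp (-(l * Y)) = 1 := by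
      rw [← Real.exp_add]; simp
    nlinarith [Real.exp_pos (l * Y), Real.add_one_le_exp (-(l * Y))]
  have h3 : l * Y * Real.exp (l * Y) ≤
      l * (ε * Real.exp (2 * |z|)) * Real.exp ((1 + z ^ 2) / 8) := by
    gcongr
  have h4 : Real.exp (2 * |z|) * Real.exp ((1 + z ^ 2) / 8) ≤ Real.exp (9 + z ^ 2 / 4) := by
    rw [← Real.exp_add, Real.exp_le_exp]
    nlinarith [sq_nonneg (|z| - 8), sq_abs z]
  have h5 := mul_le_mul_of_nonneg_left h4 (mul_nonneg hl hε.le)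
  linarith

/-- Truncating nonnegative numbers at `A` does not bring their sum below `A`
if it was above `A`. -/
lemma le_sum_min_of_lt_sum {ι : Type*} [Fintype ι] {x : ι → ℝ} {A : ℝ} (hx : ∀ i, 0 ≤ x i)
    (hA : 0 ≤ A) (h : A < ∑ i, x i) : A ≤ ∑ i, min (x i) A := by
  by_cases hall : ∀ i, x i ≤ A
  · simp only [min_eq_left (hall _)]
    exact h.le
  · push Not at hall
    obtain ⟨j, hj⟩ := hall
    calc A = min (x j) A := (min_eq_right hj.le).symm
      _ ≤ _ := Finset.single_le_sum (f := fun i => min (x i) A)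
        (fun i _ => le_min (hx i) hA) (Finset.mem_univ j)

lemma measure_lt_sum_exp_sub_one_le {n : ℕ} {ε A : ℝ} (hε : 0 < ε) (hε1 : ε ≤ 1 / 2)
    (hA : 0 < A) (hAε : Real.exp 2 ≤ A / ε)
    (hAn : 2 * (∫ z, Real.exp (9 + z ^ 2 / 4) ∂(gaussianReal 0 1)) * (n * ε) ≤ A)
    {Ω : Type*} [MeasurableSpace Ω] {P : Measure Ω} [IsProbabilityMeasure P]
    {Z : Fin n → Ω → ℝ} (hZ : ∀ i, Measurable (Z i)) (hind : iIndepFun Z P)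
    (hlaw : ∀ i, Measure.map (Z i) P = gaussianReal 0 1) :
    P {ω | A < ∑ i, (Real.exp (ε * |Z i ω|) - 1)} ≤
      ENNReal.ofReal ((A / ε) ^ (-(1 / 64 * Real.log (A / ε)))) := by
  set M := ∫ z, Real.exp (9 + z ^ 2 / 4) ∂(gaussianReal 0 1)
  set l := Real.log (A / ε) ^ 2 / (32 * A) with hl_def
  have hl : 0 ≤ l := by positivity
  let g : ℝ → ℝ := fun z => min (Real.exp (ε * |z|) - 1) A
  have hg : Measurable g := by fun_prop
  have hg0 : ∀ z, 0 ≤ Real.exp (ε * |z|) - 1 := fun z =>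
    sub_nonneg.2 (Real.one_le_exp (by positivity))
  have hYm : ∀ i, Measurable fun ω => g (Z i ω) := fun i => hg.comp (hZ i)
  have hYind : iIndepFun (fun i ω => g (Z i ω)) P := hind.comp (fun _ => g) fun _ => hg
  have hint : Integrable (fun z => Real.exp (l * g z)) (gaussianReal 0 1) := by
    refine Integrable.of_bound (by fun_prop) (Real.exp (l * A))
      (Filter.Eventually.of_forall fun z => ?_)
    rw [Real.norm_of_nonneg (Real.exp_pos _).le]
    gcongr
    exact min_le_right _ _
  have hmgf : ∀ i, mgf (fun ω => g (Z i ω)) P l ≤ Real.exp (l * ε * M) := fun i => by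
    have e : mgf (fun ω => g (Z i ω)) P l = ∫ z, Real.exp (l * g z) ∂(gaussianReal 0 1) := by
      rw [← hlaw i, integral_map (hZ i).aemeasurable (by fun_prop)]
      rfl
    have hb := integrable_exp_sq_div_four_gaussianReal.const_mul (l * ε)
    calc mgf (fun ω => g (Z i ω)) P l
        ≤ ∫ z, (1 + l * ε * Real.exp (9 + z ^ 2 / 4)) ∂(gaussianReal 0 1) := by
          rw [e]
          exact integral_mono hint ((integrable_const 1).add hb)
            (exp_tilted_truncation_le hε hε1 hA hAε)
      _ = 1 + l * ε * M := by
          rw [integral_add (integrable_const 1) hb, integral_const_mul]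
          simp [M]
      _ ≤ Real.exp (l * ε * M) := by linarith [Real.add_one_le_exp (l * ε * M)]
  have hsumint : Integrable (fun ω => Real.exp (l * (∑ i, fun ω => g (Z i ω)) ω)) P := by
    refine hYind.integrable_exp_mul_sum hYm fun i _ => ?_
    have := hint
    rw [← hlaw i] at this
    exact this.comp_measurable (hZ i)
  have hchern := measure_ge_le_exp_mul_mgf A hl hsumint
  rw [hYind.mgf_sum hYm] at hchern
  have hprod : ∏ i, mgf (fun ω => g (Z i ω)) P l ≤ Real.exp (l * ε * M) ^ n := by
    simpa using Finset.prod_le_prod (s := Finset.univ) (fun i _ => mgf_nonneg)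
      fun i _ => hmgf i
  have hfin : Real.exp (-l * A) * Real.exp (l * ε * M) ^ n ≤
      (A / ε) ^ (-(1 / 64 * Real.log (A / ε))) := by
    have hlA : l * A = Real.log (A / ε) ^ 2 / 32 := by rw [hl_def]; field_simp
    rw [← Real.exp_nat_mul, ← Real.exp_add, Real.rpow_def_of_pos (by positivity),
      Real.exp_le_exp]
    have := mul_le_mul_of_nonneg_left hAn hl
    nlinarith
  calc P {ω | A < ∑ i, (Real.exp (ε * |Z i ω|) - 1)}
      ≤ P {ω | A ≤ (∑ i, fun ω => g (Z i ω)) ω} := by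
        refine measure_mono fun ω hω => ?_
        simp only [Set.mem_ofPred_eq, Finset.sum_apply] at hω ⊢
        exact le_sum_min_of_lt_sum (fun i => hg0 (Z i ω)) hA.le hω
    _ = ENNReal.ofReal (P.real {ω | A ≤ (∑ i, fun ω => g (Z i ω)) ω}) := by simp
    _ ≤ _ := by
        refine ENNReal.ofReal_le_ofReal (hchern.trans (le_trans ?_ hfin))
        gcongr

lemma one_le_integral_exp_mul_abs {ε : ℝ} (hε : 0 < ε) (hε1 : ε ≤ 1 / 2)
    {Ω : Type*} [MeasurableSpace Ω] {P : Measure Ω} [IsProbabilityMeasure P]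
    {Z : Ω → ℝ} (hZ : Measurable Z) (hlaw : Measure.map Z P = gaussianReal 0 1) :
    1 ≤ ∫ ω, Real.exp (ε * |Z ω|) ∂P := by
  have h := integrable_exp_sq_div_four_gaussianReal
  rw [← hlaw] at h
  have hint : Integrable (fun ω => Real.exp (ε * |Z ω|)) P := by
    refine (h.comp_measurable hZ).mono' (by fun_prop) (Filter.Eventually.of_forall fun ω => ?_)
    rw [Real.norm_of_nonneg (Real.exp_pos _).le]
    refine Real.exp_le_exp.2 ?_
    nlinarith [sq_nonneg (|Z ω| - 1), sq_abs (Z ω), abs_nonneg (Z ω)]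
  calc (1 : ℝ) = ∫ _, (1 : ℝ) ∂P := by simp
    _ ≤ _ := integral_mono (integrable_const 1) hint fun ω => Real.one_le_exp (by positivity)

/-- Large deviations for sums of log-normal variables: there are constants
`ε₀ ∈ (0,1)`, `K ≥ 1`, `c > 0`, `C > 0` such that for every `n ≥ 1`, `ε ∈ (0,ε₀]` and every
family `Z₁,…,Zₙ` of independent standard Gaussian variables, the centered sums
`Sₙ = Σᵢ (e^{ε|Zᵢ|} - E[e^{ε|Zᵢ|}])` and `S̃ₙ = Σᵢ (e^{ε|Zᵢ|} - 1)` satisfy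
`P[Sₙ > A] ≤ C (A/ε)^{-c ln(A/ε)}` and `P[S̃ₙ > A] ≤ C (A/ε)^{-c ln(A/ε)}` for every
`A ≥ K max(1, nε)`. -/
theorem statement18 :
    ∃ ε₀ ∈ Set.Ioo (0:ℝ) 1, ∃ K : ℝ, 1 ≤ K ∧ ∃ c > (0:ℝ), ∃ C > (0:ℝ),
      ∀ (n : ℕ), 1 ≤ n → ∀ ε : ℝ, ε ∈ Set.Ioc (0:ℝ) ε₀ →
      ∀ (Ω : Type) (_ : MeasurableSpace Ω) (P : Measure Ω), IsProbabilityMeasure P →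
      ∀ (Z : Fin n → Ω → ℝ), (∀ i, Measurable (Z i)) →
        iIndepFun Z P →
        (∀ i, Measure.map (Z i) P = gaussianReal 0 1) →
        ∀ A : ℝ, K * max 1 ((n : ℝ) * ε) ≤ A →
          P {ω | A < ∑ i, (Real.exp (ε * |Z i ω|) - ∫ ω', Real.exp (ε * |Z i ω'|) ∂P)} ≤
            ENNReal.ofReal (C * (A / ε) ^ (-(c * Real.log (A / ε)))) ∧
          P {ω | A < ∑ i, (Real.exp (ε * |Z i ω|) - 1)} ≤
            ENNReal.ofReal (C * (A / ε) ^ (-(c * Real.log (A / ε)))) := by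
  set M := ∫ z, Real.exp (9 + z ^ 2 / 4) ∂(gaussianReal 0 1)
  have hM : 0 ≤ M := integral_nonneg fun _ => (Real.exp_pos _).le
  refine ⟨1 / 2, by norm_num, 8 + 2 * M, by linarith, 1 / 64, by norm_num, 1, one_pos, ?_⟩
  intro n _ ε ⟨hε, hε1⟩ Ω _ P _ Z hZ hind hlaw A hKA
  have hA8 : 8 ≤ A := by nlinarith [le_max_left 1 ((n : ℝ) * ε)]
  have hAn : 2 * M * (n * ε) ≤ A := by
    have := le_max_right 1 ((n : ℝ) * ε)
    have := le_max_left 1 ((n : ℝ) * ε)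
    nlinarith
  have hAε : Real.exp 2 ≤ A / ε := by
    rw [le_div_iff₀ hε]
    have he : Real.exp 2 = Real.exp 1 * Real.exp 1 := by rw [← Real.exp_add]; norm_num
    nlinarith [Real.exp_one_lt_d9, Real.exp_pos 1, Real.exp_pos 2]
  have hmain := measure_lt_sum_exp_sub_one_le hε hε1 (by linarith) hAε hAn hZ hind hlaw
  rw [one_mul]
  refine ⟨(measure_mono fun ω hω => ?_).trans hmain, hmain⟩
  refine lt_of_lt_of_le (Set.mem_ofPred.1 hω) (Finset.sum_le_sum fun i _ => ?_)
  exact sub_le_sub_left (one_le_integral_exp_mul_abs hε hε1 (hZ i) (hlaw i)) _
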